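/- Let $J_0=\begin{pmatrix}0&-1\\1&0\end{pmatrix}$ and $D=\begin{pmatrix}0&0\\0&1\end{pmatrix}$. For $n\ge 1$ and $0\le K\le n$ let $I_K$ be the set of integer tuples $k=(k_1,\dots,k_K)$ with $1\le k_1<\cdots<k_K\le n$, and for $k\in I_K$ put $$M_k = J_0^{\,n-k_K}\,D\,J_0^{\,k_K-k_{K-1}-1}\,D\,J_0^{\,k_{K-1}-k_{K-2}-1}\cdots D\,J_0^{\,k_1-1}$$ (with $M_k=J_0^{\,n}$ for the empty tuple). Then: (i) $D J_0 D = 0$, and consequently $M_k=0$ whenever $k_{j+1}-k_j=2$ for some $j$; (ii) for the full tuple $k=(1,2,\dots,n)$ one has $M_k=D$; (iii) for $n\ge 2$, the only $k\in I_{n-1}$ with $M_k\ne 0$ are $(1,\dots,n-1)$ and $(2,\dots,n)$, for which $M_k$ equals $J_0D=\begin{pmatrix}0&-1\\0&0\end{pmatrix}$ and $DJ_0=\begin{pmatrix}0&0\\1&0\end{pmatrix}$ respectively; hence for all real numbers $b_1,\dots,b_n$, $$\sum_{k\in I_{n-1}}\Bigl(\prod_{i=1}^{n-1} b_{k_i}\Bigr)M_k=\begin{pmatrix}0&-\prod_{i=1}^{n-1}b_i\\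 \prod_{i=2}^{n}b_i&0\end{pmatrix}.$$ -/

import Mathlib

namespace ReturnMap

/-- `J₀ = [[0,-1],[1,0]]`. -/
noncomputable def J₀ : Matrix (Fin 2) (Fin 2) ℝ := !![0, -1; 1, 0]

/-- `D = [[0,0],[0,1]]`. -/
noncomputable def D : Matrix (Fin 2) (Fin 2) ℝ := !![0, 0; 0, 1]

/-- `I n K` is the set of tuples `k = (k₁, …, k_K)` with `1 ≤ k₁ < ⋯ < k_K ≤ n`.
The entry `kᵢ` is `k` evaluated at the element `i - 1` of `Fin K`. -/
def I (n K : ℕ) : Finset (Fin K → ℕ) :=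
  {k ∈ Fintype.piFinset fun _ : Fin K => Finset.Icc 1 n | ∀ i j : Fin K, i < j → k i < k j}

/-- `M n k = J₀^(n-k_K) * D * J₀^(k_K-k_{K-1}-1) * D * ⋯ * D * J₀^(k₁-1)`, by recursion on the
length `K` of `k`: the factors to the right of the leftmost `D` are those of `M (k_K - 1)` at the
truncated tuple `(k₁, …, k_{K-1})`. No exponent is truncated when `k ∈ I n K`. -/
noncomputable def M (n : ℕ) : {K : ℕ} → (Fin K → ℕ) → Matrix (Fin 2) (Fin 2) ℝ
  | 0, _ => J₀ ^ n
  | K + 1, k => J₀ ^ (n - k (Fin.last K)) * D * M (k (Fin.last K) - 1) (Fin.init k)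

/-- The tuple `(a + 1, a + 2, …, a + K)`. -/
def consecutive (a K : ℕ) : Fin K → ℕ := fun i => a + 1 + (i : ℕ)

end ReturnMap

namespace ReturnMap

theorem D_mul_J₀_mul_D : D * J₀ * D = 0 := by
  ext i j; fin_cases i <;> fin_cases j <;> simp [D, J₀, Matrix.mul_apply, Fin.sum_univ_two]

theorem D_mul_D : D * D = D := by
  ext i j; fin_cases i <;> fin_cases j <;> simp [D, Matrix.mul_apply, Fin.sum_univ_two]

theorem J₀_mul_D : J₀ * D = !![0, -1; 0, 0] := by
  ext i j; fin_cases i <;> fin_cases j <;> simp [D, J₀, Matrix.mul_apply, Fin.sum_univ_two]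

theorem D_mul_J₀ : D * J₀ = !![0, 0; 1, 0] := by
  ext i j; fin_cases i <;> fin_cases j <;> simp [D, J₀, Matrix.mul_apply, Fin.sum_univ_two]

theorem M_zero (n : ℕ) (k : Fin 0 → ℕ) : M n k = J₀ ^ n := rfl

theorem M_succ (n : ℕ) {K : ℕ} (k : Fin (K + 1) → ℕ) :
    M n k = J₀ ^ (n - k (Fin.last K)) * D * M (k (Fin.last K) - 1) (Fin.init k) := rfl

/-- `M n k` vanishes if `k` has two neighbouring entries at distance two. -/
theorem M_eq_zero_of_gap_two {K : ℕ} (n : ℕ) (k : Fin K → ℕ) (i j : Fin K)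
    (hij : (j : ℕ) = i + 1) (hk : k j = k i + 2) : M n k = 0 := by
  induction K generalizing n with
  | zero => exact i.elim0
  | succ K ih =>
    rw [M_succ]
    have hi : (i : ℕ) < K := by omega
    rcases Nat.lt_succ_iff_lt_or_eq.mp j.isLt with hj | hj
    · rw [ih _ (Fin.init k) ⟨i, hi⟩ ⟨j, hj⟩ hij hk, mul_zero]
    · obtain ⟨K, rfl⟩ : ∃ L, K = L + 1 := ⟨i, by omega⟩
      obtain rfl : j = Fin.last (K + 1) := Fin.ext hj
      obtain rfl : i = (Fin.last K).castSucc := Fin.ext (by simpa using hij.symm)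
      have hgap : k (Fin.last (K + 1)) - 1 - Fin.init k (Fin.last K) = 1 := by
        simp only [Fin.init, hk]; omega
      rw [M_succ, hgap, pow_one]
      simp only [mul_assoc]
      rw [← mul_assoc J₀ D, ← mul_assoc D, ← mul_assoc D, D_mul_J₀_mul_D, zero_mul, mul_zero]

theorem init_consecutive (a K : ℕ) : Fin.init (consecutive a (K + 1)) = consecutive a K := rfl

theorem M_consecutive (n a K : ℕ) :
    M n (consecutive a (K + 1)) = J₀ ^ (n - (a + 1 + K)) * D * J₀ ^ a := by
  induction K generalizing n with
  | zero => simp [M_succ, M_zero, consecutive]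
  | succ K ih =>
    have hsub : a + 1 + (K + 1) - 1 - (a + 1 + K) = 0 := by omega
    rw [M_succ, init_consecutive, ih]
    simp only [consecutive, Fin.val_last, hsub, pow_zero, one_mul]
    rw [← mul_assoc, mul_assoc _ D D, D_mul_D]

theorem mem_I {n K : ℕ} {k : Fin K → ℕ} :
    k ∈ I n K ↔ (∀ i, 1 ≤ k i ∧ k i ≤ n) ∧ StrictMono k := by
  simp [I, StrictMono]

theorem consecutive_mem_I {n a K : ℕ} (h : a + K ≤ n) : consecutive a K ∈ I n K :=
  mem_I.mpr ⟨fun i => by simp only [consecutive]; omega,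
    fun i j hij => by simp only [consecutive]; omega⟩

theorem lower_bound_of_mem_I {n K : ℕ} {k : Fin K → ℕ} (hk : k ∈ I n K) (i : ℕ) (hi : i < K) :
    i + 1 ≤ k ⟨i, hi⟩ := by
  obtain ⟨hb, hm⟩ := mem_I.mp hk
  induction i with
  | zero => exact (hb _).1
  | succ i ih =>
    have h1 := ih (by omega)
    have h2 : k ⟨i, by omega⟩ < k ⟨i + 1, hi⟩ := hm (Fin.mk_lt_mk.mpr i.lt_succ_self)
    omega

theorem upper_bound_of_mem_I {n K : ℕ} {k : Fin K → ℕ} (hk : k ∈ I n K) (i : ℕ) (hi : i < K) :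
    k ⟨i, hi⟩ + K ≤ n + i + 1 := by
  obtain ⟨hb, hm⟩ := mem_I.mp hk
  obtain ⟨d, hd⟩ : ∃ d, i + d + 1 = K := ⟨K - i - 1, by omega⟩
  induction d generalizing i with
  | zero =>
    have := (hb ⟨i, hi⟩).2
    omega
  | succ d ih =>
    have h1 := ih (i + 1) (by omega) (by omega)
    have h2 : k ⟨i, hi⟩ < k ⟨i + 1, by omega⟩ := hm (Fin.mk_lt_mk.mpr i.lt_succ_self)
    omega

/-- A tuple omitting a single element of `{1, …, m + 2}` either omits an end point or has two
neighbouring entries at distance two. -/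
theorem eq_consecutive_of_mem_I {m : ℕ} {k : Fin (m + 1) → ℕ} (hk : k ∈ I (m + 2) (m + 1))
    (hgap : ∀ i j : Fin (m + 1), (j : ℕ) = i + 1 → k j ≠ k i + 2) :
    k = consecutive 0 (m + 1) ∨ k = consecutive 1 (m + 1) := by
  have step : ∀ (i : ℕ) (hi : i < m + 1), k ⟨i, hi⟩ = k 0 + i := by
    intro i
    induction i with
    | zero => intro _; rfl
    | succ i ih =>
      intro hi
      have h1 := ih (by omega)
      have h2 : k ⟨i, by omega⟩ < k ⟨i + 1, hi⟩ :=
        (mem_I.mp hk).2 (Fin.mk_lt_mk.mpr i.lt_succ_self)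
      have h3 := hgap ⟨i, by omega⟩ ⟨i + 1, hi⟩ rfl
      have h4 := upper_bound_of_mem_I hk (i + 1) hi
      have h5 := lower_bound_of_mem_I hk i (by omega)
      omega
  have h0 : 0 + 1 ≤ k 0 := lower_bound_of_mem_I hk 0 m.succ_pos
  have h1 : k 0 + (m + 1) ≤ m + 2 + 0 + 1 := upper_bound_of_mem_I hk 0 m.succ_pos
  obtain h | h : k 0 = 1 ∨ k 0 = 2 := by omega
  · left
    funext i
    rw [step i i.isLt, h]; simp [consecutive]
  · right
    funext i
    rw [step i i.isLt, h]; simp [consecutive]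

theorem consecutive_zero_ne_one (m : ℕ) : consecutive 0 (m + 1) ≠ consecutive 1 (m + 1) :=
  fun h => by simpa [consecutive] using congrFun h 0

theorem prod_consecutive (b : ℕ → ℝ) (a K : ℕ) :
    ∏ i, b (consecutive a K i) = ∏ i ∈ Finset.Icc (a + 1) (a + K), b i := by
  rw [← Finset.Ico_add_one_right_eq_Icc, Finset.prod_Ico_eq_prod_range,
    show a + K + 1 - (a + 1) = K by omega, Finset.prod_range]
  rfl

theorem M_consecutive_zero (m : ℕ) : M (m + 2) (consecutive 0 (m + 1)) = J₀ * D := by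
  rw [M_consecutive, show m + 2 - (0 + 1 + m) = 1 by omega, pow_one, pow_zero, mul_one]

theorem M_consecutive_one (m : ℕ) : M (m + 2) (consecutive 1 (m + 1)) = D * J₀ := by
  rw [M_consecutive, show m + 2 - (1 + 1 + m) = 0 by omega, pow_one, pow_zero, one_mul]

theorem eq_consecutive_of_M_ne_zero {m : ℕ} {k : Fin (m + 1) → ℕ} (hk : k ∈ I (m + 2) (m + 1))
    (hM : M (m + 2) k ≠ 0) : k = consecutive 0 (m + 1) ∨ k = consecutive 1 (m + 1) :=
  eq_consecutive_of_mem_I hk fun i j hij h => hM (M_eq_zero_of_gap_two _ k i j hij h)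

theorem setOf_M_ne_zero (m : ℕ) :
    {k : Fin (m + 1) → ℕ | k ∈ I (m + 2) (m + 1) ∧ M (m + 2) k ≠ 0} =
      {consecutive 0 (m + 1), consecutive 1 (m + 1)} := by
  ext k
  simp only [Set.mem_ofPred_eq, Set.mem_insert_iff, Set.mem_singleton_iff]
  constructor
  · exact fun h => eq_consecutive_of_M_ne_zero h.1 h.2
  · rintro (rfl | rfl)
    · refine ⟨consecutive_mem_I (by omega), fun h => ?_⟩
      rw [M_consecutive_zero, J₀_mul_D] at h
      simpa using congrFun (congrFun h 0) 1
    · refine ⟨consecutive_mem_I (by omega), fun h => ?_⟩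
      rw [M_consecutive_one, D_mul_J₀] at h
      simpa using congrFun (congrFun h 1) 0

theorem sum_prod_smul_M (m : ℕ) (b : ℕ → ℝ) :
    ∑ k ∈ I (m + 2) (m + 1), (∏ i, b (k i)) • M (m + 2) k =
      !![0, -∏ i ∈ Finset.Icc 1 (m + 1), b i; ∏ i ∈ Finset.Icc 2 (m + 2), b i, 0] := by
  have hsub : {consecutive 0 (m + 1), consecutive 1 (m + 1)} ⊆ I (m + 2) (m + 1) := by
    simp only [Finset.insert_subset_iff, Finset.singleton_subset_iff]
    exact ⟨consecutive_mem_I (by omega), consecutive_mem_I (by omega)⟩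
  rw [← Finset.sum_subset hsub, Finset.sum_pair (consecutive_zero_ne_one m),
    prod_consecutive, prod_consecutive, M_consecutive_zero, M_consecutive_one, J₀_mul_D, D_mul_J₀,
    show 0 + (m + 1) = m + 1 by omega, show 1 + (m + 1) = m + 2 by omega]
  · ext i j
    fin_cases i <;> fin_cases j <;> simp
  · intro k hk hne
    by_contra h
    refine hne ?_
    simpa using eq_consecutive_of_M_ne_zero hk (fun h0 => h (by rw [h0, smul_zero]))

end ReturnMap

theorem top_coefficients_of_return_map :
    -- (i)
    (ReturnMap.D * ReturnMap.J₀ * ReturnMap.D = 0 ∧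
      ∀ n : ℕ, 1 ≤ n → ∀ (K : ℕ) (k : Fin K → ℕ), k ∈ ReturnMap.I n K →
        (∃ i j : Fin K, (j : ℕ) = (i : ℕ) + 1 ∧ k j = k i + 2) →
        ReturnMap.M n k = 0) ∧
    -- (ii)
    (∀ n : ℕ, 1 ≤ n → ReturnMap.M n (ReturnMap.consecutive 0 n) = ReturnMap.D) ∧
    -- (iii)
    (∀ n : ℕ, 2 ≤ n →
      {k : Fin (n - 1) → ℕ | k ∈ ReturnMap.I n (n - 1) ∧ ReturnMap.M n k ≠ 0} =
        {ReturnMap.consecutive 0 (n - 1), ReturnMap.consecutive 1 (n - 1)} ∧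
      ReturnMap.M n (ReturnMap.consecutive 0 (n - 1)) = ReturnMap.J₀ * ReturnMap.D ∧
      ReturnMap.J₀ * ReturnMap.D = !![0, -1; 0, 0] ∧
      ReturnMap.M n (ReturnMap.consecutive 1 (n - 1)) = ReturnMap.D * ReturnMap.J₀ ∧
      ReturnMap.D * ReturnMap.J₀ = !![0, 0; 1, 0] ∧
      ∀ b : ℕ → ℝ,
        ∑ k ∈ ReturnMap.I n (n - 1), (∏ i, b (k i)) • ReturnMap.M n k =
          !![0, -∏ i ∈ Finset.Icc 1 (n - 1), b i;
             ∏ i ∈ Finset.Icc 2 n, b i, 0]) := by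
  refine ⟨⟨ReturnMap.D_mul_J₀_mul_D, fun n _ K k _ ⟨i, j, hij, h⟩ =>
      ReturnMap.M_eq_zero_of_gap_two n k i j hij h⟩,
    fun n hn => ?_, fun n hn => ?_⟩
  · obtain ⟨m, rfl⟩ := Nat.exists_eq_add_of_le' hn
    rw [ReturnMap.M_consecutive, show m + 1 - (0 + 1 + m) = 0 by omega, pow_zero, one_mul, mul_one]
  · obtain ⟨m, rfl⟩ := Nat.exists_eq_add_of_le' hn
    exact ⟨ReturnMap.setOf_M_ne_zero m, ReturnMap.M_consecutive_zero m, ReturnMap.J₀_mul_D,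
      ReturnMap.M_consecutive_one m, ReturnMap.D_mul_J₀, ReturnMap.sum_prod_smul_M m⟩
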